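/- arXiv:2503.12056 — 10 statements merged into one kernel-verified Lean document; each statement's English description precedes it below -/
import Mathlib

section
/- For every dimension d ≥ 1 and every c > 0, the map ŵ : B_c(0) → ℝ^d, ŵ(v) := Γ(v)(1 + Γ(v)/c²)·v, is a bijection from the open ball of radius c onto all of ℝ^d (it is injective on B_c(0) and every w ∈ ℝ^d equals ŵ(v) for some v with ‖v‖ < c). -/
open Real

/-- The Lorentz factor `Γ(v) = c / √(c² − ‖v‖²)`. -/
noncomputable def Gam (c : ℝ) {d : ℕ} (v : EuclideanSpace ℝ (Fin d)) : ℝ :=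
  c / Real.sqrt (c ^ 2 - ‖v‖ ^ 2)

/-- The relativistic-velocity map `ŵ(v) = Γ(v)(1 + Γ(v)/c²)·v`. -/
noncomputable def what (c : ℝ) {d : ℕ} (v : EuclideanSpace ℝ (Fin d)) :
    EuclideanSpace ℝ (Fin d) :=
  (Gam c v * (1 + Gam c v / c ^ 2)) • v

/-- scalar Lorentz factor. -/
noncomputable def gS (c r : ℝ) : ℝ := c / Real.sqrt (c ^ 2 - r ^ 2)

/-- scalar multiplier. -/
noncomputable def fS (c r : ℝ) : ℝ := gS c r * (1 + gS c r / c ^ 2)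

lemma what_eq (c : ℝ) {d : ℕ} (v : EuclideanSpace ℝ (Fin d)) : what c v = fS c ‖v‖ • v := rfl

lemma sub_pos' {c r : ℝ} (hr : 0 ≤ r) (h : r < c) : 0 < c ^ 2 - r ^ 2 := by nlinarith

lemma gS_pos {c r : ℝ} (hr : 0 ≤ r) (h : r < c) : 0 < gS c r :=
  div_pos (by linarith) (Real.sqrt_pos.2 (sub_pos' hr h))

lemma fS_pos {c r : ℝ} (hr : 0 ≤ r) (h : r < c) : 0 < fS c r := by
  have := gS_pos hr h
  have hc : 0 < c := by linarith
  unfold fS; positivity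

lemma gS_mono {c r s : ℝ} (hr : 0 ≤ r) (hrs : r ≤ s) (h : s < c) : gS c r ≤ gS c s := by
  have h1 := Real.sqrt_pos.2 (sub_pos' (hr.trans hrs) h)
  have hc : 0 < c := by linarith
  unfold gS
  gcongr

lemma fS_mono {c r s : ℝ} (hr : 0 ≤ r) (hrs : r ≤ s) (h : s < c) : fS c r ≤ fS c s := by
  have h1 := gS_mono hr hrs h
  have h2 := gS_pos hr (hrs.trans_lt h)
  have h3 := h2.le.trans h1
  have hc : 0 < c := by linarith
  unfold fS
  gcongr

lemma fS_mul_lt {c r s : ℝ} (hr : 0 ≤ r) (hrs : r < s) (h : s < c) :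
    fS c r * r < fS c s * s := by
  have h1 := fS_mono hr hrs.le h
  have h2 := fS_pos (hr.trans hrs.le) h
  nlinarith

lemma fS_surj {c W : ℝ} (hc : 0 < c) (hW : 0 ≤ W) :
    ∃ r, 0 ≤ r ∧ r < c ∧ fS c r * r = W := by
  set S := Real.sqrt (c ^ 2 + W ^ 2) with hS
  have hSp : 0 < S := Real.sqrt_pos.2 (by positivity)
  have hS2 : S ^ 2 = c ^ 2 + W ^ 2 := Real.sq_sqrt (by positivity)
  have hWS : W < S := by nlinarith
  have h0 : 0 ≤ c * W / S := by positivity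
  have hlt : c * W / S < c := by
    rw [div_lt_iff₀ hSp]; nlinarith
  have hg : gS c (c * W / S) * (c * W / S) = W := by
    have : c ^ 2 - (c * W / S) ^ 2 = (c ^ 2 / S) ^ 2 := by
      field_simp; nlinarith
    unfold gS
    rw [this, Real.sqrt_sq (by positivity)]
    field_simp
  have hcont : ContinuousOn (fun r => fS c r * r) (Set.Icc 0 (c * W / S)) := by
    have hgc : ContinuousOn (fun r => gS c r) (Set.Icc 0 (c * W / S)) := by
      unfold gS
      refine ContinuousOn.div (by fun_prop) (by fun_prop) ?_
      intro x hx
      exact (Real.sqrt_pos.2 (sub_pos' hx.1 (hx.2.trans_lt hlt))).ne'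
    unfold fS
    fun_prop
  have hge : W ≤ fS c (c * W / S) * (c * W / S) := by
    have hp := gS_pos h0 hlt
    have : gS c (c * W / S) ≤ fS c (c * W / S) := by
      unfold fS
      have : 0 ≤ gS c (c * W / S) / c ^ 2 := by positivity
      nlinarith
    nlinarith
  obtain ⟨r, hr, h⟩ := intermediate_value_Icc h0 hcont ⟨by simpa using hW, hge⟩
  exact ⟨r, hr.1, hr.2.trans_lt hlt, h⟩

theorem stmt1 (d : ℕ) (hd : 1 ≤ d) (c : ℝ) (hc : 0 < c) :
    (∀ v₁ v₂ : EuclideanSpace ℝ (Fin d), ‖v₁‖ < c → ‖v₂‖ < c →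
      what c v₁ = what c v₂ → v₁ = v₂) ∧
    (∀ w : EuclideanSpace ℝ (Fin d), ∃ v : EuclideanSpace ℝ (Fin d),
      ‖v‖ < c ∧ what c v = w) := by
  constructor
  · intro v₁ v₂ h₁ h₂ h
    rw [what_eq, what_eq] at h
    have p₁ := fS_pos (norm_nonneg v₁) h₁
    have p₂ := fS_pos (norm_nonneg v₂) h₂
    have hn : fS c ‖v₁‖ * ‖v₁‖ = fS c ‖v₂‖ * ‖v₂‖ := by
      have := congrArg norm h
      rwa [norm_smul, norm_smul, Real.norm_of_nonneg p₁.le, Real.norm_of_nonneg p₂.le] at this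
    have hr : ‖v₁‖ = ‖v₂‖ := by
      rcases lt_trichotomy ‖v₁‖ ‖v₂‖ with hl | he | hl
      · exact absurd hn (fS_mul_lt (norm_nonneg _) hl h₂).ne
      · exact he
      · exact absurd hn (fS_mul_lt (norm_nonneg _) hl h₁).ne'
    rw [hr] at h
    exact smul_right_injective _ p₂.ne' h
  · intro w
    obtain ⟨r, hr0, hrc, hr⟩ := fS_surj hc (norm_nonneg w)
    have hp := fS_pos hr0 hrc
    have hv : ‖(fS c r)⁻¹ • w‖ = r := by
      rw [norm_smul, Real.norm_of_nonneg (inv_nonneg.2 hp.le), ← hr]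
      field_simp
    refine ⟨(fS c r)⁻¹ • w, by rw [hv]; exact hrc, ?_⟩
    rw [what_eq, hv, smul_inv_smul₀ hp.ne']
end

section
/- Define the local energy E : B_c(0) → ℝ by E(v) := c²(Γ(v) − 1) + Γ(v)² − log Γ(v). Then for every v ∈ B_c(0), both E and ŵ are differentiable at v and for every h ∈ ℝ^d one has DE(v)[h] = ⟨v, Dŵ(v)[h]⟩, where ⟨·,·⟩ is the Euclidean inner product. (Equivalently, the gradient of E with respect to the relativistic velocity w = ŵ(v) equals v.) -/
open Real
open scoped RealInnerProductSpace

/-- The local energy `E(v) = c²(Γ(v) − 1) + Γ(v)² − log Γ(v)`. -/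
noncomputable def Ener (c : ℝ) {d : ℕ} (v : EuclideanSpace ℝ (Fin d)) : ℝ :=
  c ^ 2 * (Gam c v - 1) + (Gam c v) ^ 2 - Real.log (Gam c v)

theorem Gam_hasFDerivAt (d : ℕ) (c : ℝ) (hc : 0 < c)
    (v : EuclideanSpace ℝ (Fin d)) (hv : ‖v‖ < c) :
    HasFDerivAt (Gam c) ((Gam c v ^ 3 / c ^ 2) • innerSL ℝ v) v := by
  have hs : 0 < c ^ 2 - ‖v‖ ^ 2 := by nlinarith [norm_nonneg v]
  have hq : 0 < √(c ^ 2 - ‖v‖ ^ 2) := Real.sqrt_pos.mpr hs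
  have h1 : HasFDerivAt (fun x : EuclideanSpace ℝ (Fin d) => c ^ 2 - ‖x‖ ^ 2)
      (-(2 • innerSL ℝ v)) v :=
    (HasStrictFDerivAt.hasFDerivAt (hasStrictFDerivAt_norm_sq v)).const_sub (c ^ 2)
  have h2 : HasDerivAt (fun s : ℝ => c / √s) _ (c ^ 2 - ‖v‖ ^ 2) :=
    (hasDerivAt_const _ c).div (Real.hasDerivAt_sqrt hs.ne') hq.ne'
  have h3 := h2.comp_hasFDerivAt v h1
  refine h3.congr_fderiv ?_
  ext h
  simp only [Gam, ContinuousLinearMap.smul_apply, ContinuousLinearMap.neg_apply, smul_eq_mul,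
    nsmul_eq_mul]
  push_cast
  field_simp
  ring

theorem stmt2 (d : ℕ) (hd : 1 ≤ d) (c : ℝ) (hc : 0 < c)
    (v : EuclideanSpace ℝ (Fin d)) (hv : ‖v‖ < c) :
    DifferentiableAt ℝ (Ener c) v ∧ DifferentiableAt ℝ (what c) v ∧
    ∀ h : EuclideanSpace ℝ (Fin d),
      fderiv ℝ (Ener c) v h = ⟪v, fderiv ℝ (what c) v h⟫ := by
  have hs : 0 < c ^ 2 - ‖v‖ ^ 2 := by nlinarith [norm_nonneg v]
  have hq : 0 < √(c ^ 2 - ‖v‖ ^ 2) := Real.sqrt_pos.mpr hs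
  have hG : 0 < Gam c v := div_pos hc hq
  have hn : ‖v‖ ^ 2 = c ^ 2 - c ^ 2 / Gam c v ^ 2 := by
    have := Real.sq_sqrt hs.le
    unfold Gam
    field_simp
    linarith
  have hD := Gam_hasFDerivAt d c hc v hv
  have hE : HasFDerivAt (Ener c) _ v :=
    (((hD.sub_const 1).const_mul (c ^ 2)).add (hD.pow 2)).sub (hD.log hG.ne')
  have hm : HasDerivAt (fun g : ℝ => g * (1 + g / c ^ 2)) _ (Gam c v) :=
    (hasDerivAt_id' _).mul (((hasDerivAt_id' _).div_const (c ^ 2)).const_add 1)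
  have hW : HasFDerivAt (what c) _ v :=
    (hm.comp_hasFDerivAt v hD).smul (hasFDerivAt_id v)
  refine ⟨hE.differentiableAt, hW.differentiableAt, fun h => ?_⟩
  rw [hE.fderiv, hW.fderiv]
  simp [inner_add_right, inner_smul_right]
  rw [hn]
  generalize Gam c v = G at *
  field_simp
  ring
end

section
/- For every v ∈ B_c(0), the map ŵ is differentiable at v and its Jacobian Dŵ(v) acts as follows: Dŵ(v)[u] = λ₁(‖v‖)·u for every u ∈ ℝ^d with ⟨u, v⟩ = 0, and Dŵ(v)[v] = λ₂(‖v‖)·v. In particular, Dŵ(v) has eigenvalue λ₁(‖v‖) with multiplicity d − 1 and eigenvalue λ₂(‖v‖) with multiplicity 1. -/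
open Real
open scoped RealInnerProductSpace

/-- `λ₁(r) = c/√(c² − r²) + 1/(c² − r²)`. -/
noncomputable def lam1 (c r : ℝ) : ℝ :=
  c / Real.sqrt (c ^ 2 - r ^ 2) + 1 / (c ^ 2 - r ^ 2)

/-- `λ₂(r) = c·r²/(c² − r²)^{3/2} + 2r²/(c² − r²)² + c/√(c² − r²) + 1/(c² − r²)`. -/
noncomputable def lam2 (c r : ℝ) : ℝ :=
  c * r ^ 2 / (c ^ 2 - r ^ 2) ^ ((3 : ℝ) / 2) + 2 * r ^ 2 / (c ^ 2 - r ^ 2) ^ 2 +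
    c / Real.sqrt (c ^ 2 - r ^ 2) + 1 / (c ^ 2 - r ^ 2)

theorem hasDerivAt_aux (c t : ℝ) (hc : 0 < c) (h : 0 < c ^ 2 - t) :
    HasDerivAt (fun t : ℝ => c / Real.sqrt (c ^ 2 - t) * (1 + c / Real.sqrt (c ^ 2 - t) / c ^ 2))
      (c / (2 * Real.sqrt (c ^ 2 - t) ^ 3) + 1 / Real.sqrt (c ^ 2 - t) ^ 4) t := by
  have hs : 0 < Real.sqrt (c ^ 2 - t) := Real.sqrt_pos.mpr h
  have h1 : HasDerivAt (fun t : ℝ => c ^ 2 - t) (-1) t := by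
    simpa using (hasDerivAt_id t).const_sub (c ^ 2)
  have h2 := h1.sqrt h.ne'
  have h3 := (hasDerivAt_const t c).fun_div h2 hs.ne'
  have h4 := h3.fun_mul ((h3.div_const (c ^ 2)).const_add 1)
  refine h4.congr_deriv ?_
  generalize Real.sqrt (c ^ 2 - t) = s at hs
  field_simp
  ring

theorem hasFDerivAt_aux (d : ℕ) (c : ℝ) (hc : 0 < c)
    (v : EuclideanSpace ℝ (Fin d)) (hv : ‖v‖ < c) :
    ∃ L : EuclideanSpace ℝ (Fin d) →L[ℝ] EuclideanSpace ℝ (Fin d),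
      HasFDerivAt (what c) L v ∧ ∀ u, L u = lam1 c ‖v‖ • u +
        ((c / (2 * Real.sqrt (c ^ 2 - ‖v‖ ^ 2) ^ 3) + 1 / Real.sqrt (c ^ 2 - ‖v‖ ^ 2) ^ 4)
          * (2 * ⟪v, u⟫)) • v := by
  have h : 0 < c ^ 2 - ‖v‖ ^ 2 := by nlinarith [norm_nonneg v]
  have hs : 0 < Real.sqrt (c ^ 2 - ‖v‖ ^ 2) := Real.sqrt_pos.mpr h
  have h1 := (hasStrictFDerivAt_norm_sq v).hasFDerivAt
  have h2 := (hasDerivAt_aux c (‖v‖ ^ 2) hc h).comp_hasFDerivAt v h1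
  have h3 := h2.smul (hasFDerivAt_id v)
  refine ⟨_, h3, fun u => ?_⟩
  have e : c / Real.sqrt (c ^ 2 - ‖v‖ ^ 2) * (1 + c / Real.sqrt (c ^ 2 - ‖v‖ ^ 2) / c ^ 2)
      = lam1 c ‖v‖ := by
    unfold lam1
    rw [show 1 / (c ^ 2 - ‖v‖ ^ 2) = 1 / Real.sqrt (c ^ 2 - ‖v‖ ^ 2) ^ 2 by
      rw [Real.sq_sqrt h.le]]
    field_simp
  simp [e]

theorem stmt3 (d : ℕ) (hd : 1 ≤ d) (c : ℝ) (hc : 0 < c)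
    (v : EuclideanSpace ℝ (Fin d)) (hv : ‖v‖ < c) :
    DifferentiableAt ℝ (what c) v ∧
    (∀ u : EuclideanSpace ℝ (Fin d), ⟪u, v⟫ = 0 →
      fderiv ℝ (what c) v u = lam1 c ‖v‖ • u) ∧
    fderiv ℝ (what c) v v = lam2 c ‖v‖ • v := by
  obtain ⟨L, hL, hu⟩ := hasFDerivAt_aux d c hc v hv
  have h : 0 < c ^ 2 - ‖v‖ ^ 2 := by nlinarith [norm_nonneg v]
  have hs : 0 < Real.sqrt (c ^ 2 - ‖v‖ ^ 2) := Real.sqrt_pos.mpr h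
  refine ⟨hL.differentiableAt, fun u huv => ?_, ?_⟩
  · rw [hL.fderiv, hu, real_inner_comm, huv]
    simp
  · rw [hL.fderiv, hu, real_inner_self_eq_norm_sq, ← add_smul]
    congr 1
    have e3 : (c ^ 2 - ‖v‖ ^ 2) ^ ((3 : ℝ) / 2) = Real.sqrt (c ^ 2 - ‖v‖ ^ 2) ^ 3 := by
      rw [Real.sqrt_eq_rpow, ← Real.rpow_mul_natCast h.le]
      norm_num
    have e4 : (c ^ 2 - ‖v‖ ^ 2) ^ 2 = Real.sqrt (c ^ 2 - ‖v‖ ^ 2) ^ 4 := by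
      rw [show (4 : ℕ) = 2 * 2 by norm_num, pow_mul, Real.sq_sqrt h.le]
    unfold lam1 lam2
    rw [e3, e4]
    generalize 1 / (c ^ 2 - ‖v‖ ^ 2) = w
    field_simp
    ring
end

section
/- For every v ∈ B_c(0), the operator norm of the Jacobian of ŵ satisfies ‖Dŵ(v)‖_op = λ₂(‖v‖). Consequently, for every 0 ≤ V < c and all v₁, v₂ ∈ ℝ^d with ‖v₁‖ ≤ V and ‖v₂‖ ≤ V, one has ‖ŵ(v₁) − ŵ(v₂)‖ ≤ λ₂(V)·‖v₁ − v₂‖. -/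
open Real

lemma aux_deriv (c s : ℝ) (hs : s < c ^ 2) :
    HasDerivAt (fun s : ℝ => c / √(c ^ 2 - s) + 1 / (c ^ 2 - s))
      (c / (2 * √(c ^ 2 - s) ^ 3) + 1 / (c ^ 2 - s) ^ 2) s := by
  have hp : 0 < c ^ 2 - s := by linarith
  have hK : 0 < √(c ^ 2 - s) := Real.sqrt_pos.2 hp
  have h1 : HasDerivAt (fun s : ℝ => c ^ 2 - s) (-1) s := by
    simpa using (hasDerivAt_id s).const_sub (c ^ 2)
  have h2 := (h1.sqrt hp.ne').inv hK.ne'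
  have h3 := (h2.const_mul c).add (h1.inv hp.ne')
  have e1 : (fun s : ℝ => c / √(c ^ 2 - s) + 1 / (c ^ 2 - s)) =
      ((fun y => c * (fun y => √(c ^ 2 - y))⁻¹ y) + (fun s => c ^ 2 - s)⁻¹) := by
    funext t
    simp [div_eq_mul_inv]
  have e2 : c / (2 * √(c ^ 2 - s) ^ 3) + 1 / (c ^ 2 - s) ^ 2 =
      c * (-(-1 / (2 * √(c ^ 2 - s))) / √(c ^ 2 - s) ^ 2) + - -1 / (c ^ 2 - s) ^ 2 := by
    rw [neg_neg]
    congr 1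
    field_simp
  rw [e1, e2]
  exact h3

lemma aux_what (c : ℝ) (hc : 0 < c) {d : ℕ} (v : EuclideanSpace ℝ (Fin d)) (hv : ‖v‖ < c) :
    what c v = (c / √(c ^ 2 - ‖v‖ ^ 2) + 1 / (c ^ 2 - ‖v‖ ^ 2)) • v := by
  have hp : 0 < c ^ 2 - ‖v‖ ^ 2 := by nlinarith [norm_nonneg v]
  have hK : 0 < √(c ^ 2 - ‖v‖ ^ 2) := Real.sqrt_pos.2 hp
  have hsq := Real.sq_sqrt hp.le
  unfold what Gam
  congr 1
  rw [← hsq, Real.sqrt_sq hK.le]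
  field_simp

lemma aux_fderiv (c : ℝ) (hc : 0 < c) {d : ℕ} (v : EuclideanSpace ℝ (Fin d)) (hv : ‖v‖ < c) :
    ∃ L : EuclideanSpace ℝ (Fin d) →L[ℝ] EuclideanSpace ℝ (Fin d),
      HasFDerivAt (what c) L v ∧
      ∀ h, L h = (c / √(c ^ 2 - ‖v‖ ^ 2) + 1 / (c ^ 2 - ‖v‖ ^ 2)) • h +
        ((c / (2 * √(c ^ 2 - ‖v‖ ^ 2) ^ 3) + 1 / (c ^ 2 - ‖v‖ ^ 2) ^ 2) *
          (2 * inner ℝ v h)) • v := by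
  have hs : ‖v‖ ^ 2 < c ^ 2 := by nlinarith [norm_nonneg v]
  have h1 : HasFDerivAt (fun x : EuclideanSpace ℝ (Fin d) => ‖x‖ ^ 2) _ v :=
    (hasStrictFDerivAt_norm_sq v).hasFDerivAt
  have h2 := (aux_deriv c _ hs).comp_hasFDerivAt v h1
  have h3 := h2.smul (hasFDerivAt_id (𝕜 := ℝ) v)
  refine ⟨_, h3.congr_of_eventuallyEq ?_, ?_⟩
  · have : ∀ᶠ x : EuclideanSpace ℝ (Fin d) in nhds v, ‖x‖ < c :=
      continuous_norm.continuousAt.eventually_lt continuousAt_const hv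
    filter_upwards [this] with x hx
    rw [aux_what c hc x hx]
    rfl
  · intro h
    simp

lemma aux_lam2 (c r : ℝ) (hr : r ^ 2 < c ^ 2) :
    lam2 c r = (c / √(c ^ 2 - r ^ 2) + 1 / (c ^ 2 - r ^ 2)) +
      (c / (2 * √(c ^ 2 - r ^ 2) ^ 3) + 1 / (c ^ 2 - r ^ 2) ^ 2) * 2 * r ^ 2 := by
  have hp : 0 < c ^ 2 - r ^ 2 := by linarith
  have hK : 0 < √(c ^ 2 - r ^ 2) := Real.sqrt_pos.2 hp
  have : (c ^ 2 - r ^ 2) ^ ((3 : ℝ) / 2) = √(c ^ 2 - r ^ 2) ^ 3 := by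
    generalize c ^ 2 - r ^ 2 = x at *
    rw [Real.sqrt_eq_rpow, ← Real.rpow_natCast, ← Real.rpow_mul hp.le]
    norm_num
  unfold lam2
  rw [this]
  field_simp
  ring

lemma aux_mono (c r V : ℝ) (hc : 0 < c) (hr : 0 ≤ r) (hrV : r ≤ V) (hV : V < c) :
    lam2 c r ≤ lam2 c V := by
  have hp : 0 < c ^ 2 - V ^ 2 := by nlinarith
  have h : c ^ 2 - V ^ 2 ≤ c ^ 2 - r ^ 2 := by nlinarith
  unfold lam2
  have hK : 0 < √(c ^ 2 - V ^ 2) := Real.sqrt_pos.2 hp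
  gcongr

lemma aux_norm (c : ℝ) (hc : 0 < c) {d : ℕ} (hd : 1 ≤ d) (v : EuclideanSpace ℝ (Fin d))
    (hv : ‖v‖ < c) : ‖fderiv ℝ (what c) v‖ = lam2 c ‖v‖ := by
  have hs : ‖v‖ ^ 2 < c ^ 2 := by nlinarith [norm_nonneg v]
  have hp : 0 < c ^ 2 - ‖v‖ ^ 2 := by linarith
  have hK : 0 < √(c ^ 2 - ‖v‖ ^ 2) := Real.sqrt_pos.2 hp
  obtain ⟨L, hL, hLf⟩ := aux_fderiv c hc v hv
  rw [hL.fderiv, aux_lam2 c _ hs]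
  have ha : 0 ≤ c / √(c ^ 2 - ‖v‖ ^ 2) + 1 / (c ^ 2 - ‖v‖ ^ 2) := by positivity
  have hb : 0 ≤ c / (2 * √(c ^ 2 - ‖v‖ ^ 2) ^ 3) + 1 / (c ^ 2 - ‖v‖ ^ 2) ^ 2 := by positivity
  generalize c / √(c ^ 2 - ‖v‖ ^ 2) + 1 / (c ^ 2 - ‖v‖ ^ 2) = a at *
  generalize c / (2 * √(c ^ 2 - ‖v‖ ^ 2) ^ 3) + 1 / (c ^ 2 - ‖v‖ ^ 2) ^ 2 = b at *
  apply le_antisymm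
  · refine L.opNorm_le_bound (by positivity) fun h => ?_
    rw [hLf]
    refine (norm_add_le _ _).trans ?_
    rw [norm_smul, norm_smul, norm_mul, norm_mul, Real.norm_of_nonneg ha, Real.norm_of_nonneg hb]
    have h1 := norm_inner_le_norm (𝕜 := ℝ) v h
    calc _ ≤ a * ‖h‖ + b * (‖(2 : ℝ)‖ * (‖v‖ * ‖h‖)) * ‖v‖ := by gcongr
      _ = _ := by simp; ring
  · by_cases h0 : v = 0
    · subst h0
      have h1 := L.le_opNorm (EuclideanSpace.single (⟨0, hd⟩ : Fin d) (1 : ℝ))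
      rw [hLf] at h1
      simpa [norm_smul, abs_of_nonneg ha] using h1
    · have hv0 : 0 < ‖v‖ := norm_pos_iff.2 h0
      have h1 := L.le_opNorm v
      rw [hLf, real_inner_self_eq_norm_sq, ← add_smul, norm_smul,
        Real.norm_of_nonneg (by positivity)] at h1
      have := le_of_mul_le_mul_right h1 hv0
      linarith

theorem stmt5 (d : ℕ) (hd : 1 ≤ d) (c : ℝ) (hc : 0 < c) :
    (∀ v : EuclideanSpace ℝ (Fin d), ‖v‖ < c →
      ‖fderiv ℝ (what c) v‖ = lam2 c ‖v‖) ∧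
    ∀ V : ℝ, 0 ≤ V → V < c →
      ∀ v₁ v₂ : EuclideanSpace ℝ (Fin d), ‖v₁‖ ≤ V → ‖v₂‖ ≤ V →
        ‖what c v₁ - what c v₂‖ ≤ lam2 c V * ‖v₁ - v₂‖ := by
  refine ⟨fun v hv => aux_norm c hc hd v hv, fun V hV0 hV v₁ v₂ h₁ h₂ => ?_⟩
  refine (convex_closedBall (0 : EuclideanSpace ℝ (Fin d)) V).norm_image_sub_le_of_norm_fderiv_le
    (𝕜 := ℝ) (f := what c) ?_ ?_ (by simpa using h₂) (by simpa using h₁)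
  · intro x hx
    obtain ⟨L, hL, -⟩ := aux_fderiv c hc x (lt_of_le_of_lt (by simpa using hx) hV)
    exact hL.differentiableAt
  · intro x hx
    have hx' : ‖x‖ ≤ V := by simpa using hx
    rw [aux_norm c hc hd x (hx'.trans_lt hV)]
    exact aux_mono c _ V hc (norm_nonneg x) hx' hV
end

section
/- For every v ∈ B_c(0), the determinant of the Jacobian Dŵ(v) (as a linear map of ℝ^d) equals λ₁(‖v‖)^{d−1}·λ₂(‖v‖); in particular det Dŵ(v) > 1. -/
open Real

lemma g_deriv (c t : ℝ) (hc : 0 < c) (ht : 0 < c ^ 2 - t) :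
    HasDerivAt (fun t : ℝ => c / √(c ^ 2 - t) * (1 + c / √(c ^ 2 - t) / c ^ 2))
      (c / (2 * √(c ^ 2 - t) ^ 3) + 1 / √(c ^ 2 - t) ^ 4) t := by
  have hs : 0 < √(c ^ 2 - t) := Real.sqrt_pos.mpr ht
  have h1 : HasDerivAt (fun t : ℝ => √(c ^ 2 - t)) (-1 / (2 * √(c ^ 2 - t))) t :=
    ((hasDerivAt_id t).const_sub (c ^ 2)).sqrt ht.ne'
  have h2 := (hasDerivAt_const t c).fun_div h1 hs.ne'
  have h3 := h2.fun_mul ((h2.div_const (c ^ 2)).const_add 1)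
  refine h3.congr_deriv ?_
  field_simp
  ring

lemma what_fderiv (d : ℕ) (c : ℝ) (hc : 0 < c)
    (v : EuclideanSpace ℝ (Fin d)) (hv : 0 < c ^ 2 - ‖v‖ ^ 2) (x : EuclideanSpace ℝ (Fin d)) :
    fderiv ℝ (what c) v x = (Gam c v * (1 + Gam c v / c ^ 2)) • x +
      ((c / (2 * √(c ^ 2 - ‖v‖ ^ 2) ^ 3) + 1 / √(c ^ 2 - ‖v‖ ^ 2) ^ 4) * (2 * inner ℝ v x)) • v := by
  have h1 := (hasStrictFDerivAt_norm_sq v).hasFDerivAt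
  have h2 := (g_deriv c (‖v‖ ^ 2) hc hv).comp_hasFDerivAt v h1
  have h3 := h2.fun_smul (hasFDerivAt_id v)
  have h4 : HasFDerivAt (what c) _ v := h3
  rw [h4.fderiv]
  simp [Gam]

theorem stmt6 (d : ℕ) (hd : 1 ≤ d) (c : ℝ) (hc : 0 < c)
    (v : EuclideanSpace ℝ (Fin d)) (hv : ‖v‖ < c) :
    LinearMap.det (fderiv ℝ (what c) v).toLinearMap
      = lam1 c ‖v‖ ^ (d - 1) * lam2 c ‖v‖ ∧
    1 < LinearMap.det (fderiv ℝ (what c) v).toLinearMap := by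
  have hpos : 0 < c ^ 2 - ‖v‖ ^ 2 := by nlinarith [norm_nonneg v]
  have hs : 0 < √(c ^ 2 - ‖v‖ ^ 2) := Real.sqrt_pos.mpr hpos
  have hsq : √(c ^ 2 - ‖v‖ ^ 2) ^ 2 = c ^ 2 - ‖v‖ ^ 2 := Real.sq_sqrt hpos.le
  have hsc : √(c ^ 2 - ‖v‖ ^ 2) ≤ c := by
    rw [Real.sqrt_le_left hc.le]; nlinarith [norm_nonneg v]
  have hl1 : 1 < lam1 c ‖v‖ := by
    have h1 : 1 ≤ c / √(c ^ 2 - ‖v‖ ^ 2) := (one_le_div hs).mpr hsc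
    have h2 : 0 < 1 / (c ^ 2 - ‖v‖ ^ 2) := by positivity
    unfold lam1; linarith
  have hl2 : 1 < lam2 c ‖v‖ := by
    have h1 : 0 ≤ c * ‖v‖ ^ 2 / (c ^ 2 - ‖v‖ ^ 2) ^ ((3 : ℝ) / 2) := by positivity
    have h2 : 0 ≤ 2 * ‖v‖ ^ 2 / (c ^ 2 - ‖v‖ ^ 2) ^ 2 := by positivity
    unfold lam1 at hl1; unfold lam2; linarith
  have hg : Gam c v * (1 + Gam c v / c ^ 2) = lam1 c ‖v‖ := by
    unfold Gam lam1
    rw [← hsq, Real.sqrt_sq hs.le]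
    field_simp
  have h32 : (c ^ 2 - ‖v‖ ^ 2) ^ ((3 : ℝ) / 2) = √(c ^ 2 - ‖v‖ ^ 2) ^ 3 := by
    rw [Real.sqrt_eq_rpow, ← Real.rpow_mul_natCast hpos.le]; norm_num
  set k := c / (2 * √(c ^ 2 - ‖v‖ ^ 2) ^ 3) + 1 / √(c ^ 2 - ‖v‖ ^ 2) ^ 4 with hk
  have hl : lam2 c ‖v‖ = lam1 c ‖v‖ + k * (2 * ‖v‖ ^ 2) := by
    have h4 : √(c ^ 2 - ‖v‖ ^ 2) ^ 4 = (c ^ 2 - ‖v‖ ^ 2) ^ 2 := by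
      calc _ = (√(c ^ 2 - ‖v‖ ^ 2) ^ 2) ^ 2 := by ring
        _ = _ := by rw [hsq]
    unfold lam2 lam1
    rw [hk, h32, h4]
    field_simp
    ring
  have hl0 : lam1 c ‖v‖ ≠ 0 := by linarith
  have hdet : LinearMap.det (fderiv ℝ (what c) v).toLinearMap
      = lam1 c ‖v‖ ^ (d - 1) * lam2 c ‖v‖ := by
    have e : (fderiv ℝ (what c) v).toLinearMap = lam1 c ‖v‖ •
        LinearMap.transvection ((2 * k / lam1 c ‖v‖) • (innerSL ℝ v).toLinearMap) v := by
      refine LinearMap.ext fun x => ?_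
      have := what_fderiv d c hc v hpos x
      rw [hg, ← hk] at this
      refine this.trans ?_
      simp only [LinearMap.smul_apply, LinearMap.transvection.apply, smul_add, smul_smul,
        ContinuousLinearMap.coe_coe, innerSL_apply_apply, smul_eq_mul]
      congr 2
      field_simp
    rw [e, LinearMap.det_smul, LinearMap.transvection.det, finrank_euclideanSpace_fin, hl]
    simp only [LinearMap.smul_apply, ContinuousLinearMap.coe_coe, innerSL_apply_apply,
      smul_eq_mul, real_inner_self_eq_norm_sq]
    obtain ⟨n, rfl⟩ : ∃ n, d = n + 1 := ⟨d - 1, by omega⟩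
    rw [Nat.add_sub_cancel, pow_succ]
    field_simp
  refine ⟨hdet, ?_⟩
  rw [hdet]
  have := one_le_pow₀ hl1.le (n := d - 1)
  nlinarith
end

section
/- For all v₁, v₂ ∈ B_c(0), writing w₁ := ŵ(v₁) and w₂ := ŵ(v₂), one has the two-sided monotonicity estimate ((c² + 1)/c²)·‖v₁ − v₂‖² ≤ ⟨v₁ − v₂, w₁ − w₂⟩ ≤ (c²/(c² + 1))·‖w₁ − w₂‖², where ⟨·,·⟩ is the Euclidean inner product on ℝ^d. -/
open Real
open scoped RealInnerProductSpace

theorem aux_gam_one (c : ℝ) (hc : 0 < c) {d : ℕ} (v : EuclideanSpace ℝ (Fin d)) (h : ‖v‖ < c) :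
    1 ≤ Gam c v := by
  have h0 := norm_nonneg v
  have hp : 0 < c ^ 2 - ‖v‖ ^ 2 := by nlinarith
  unfold Gam
  rw [one_le_div (Real.sqrt_pos.2 hp), Real.sqrt_le_left hc.le]
  nlinarith

theorem aux_gam_mono (c : ℝ) (hc : 0 < c) {d : ℕ} (v w : EuclideanSpace ℝ (Fin d))
    (h : ‖w‖ < c) (hvw : ‖v‖ ≤ ‖w‖) : Gam c v ≤ Gam c w := by
  have h0 := norm_nonneg v
  have hp : 0 < c ^ 2 - ‖w‖ ^ 2 := by nlinarith
  unfold Gam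
  apply div_le_div_of_nonneg_left hc.le (Real.sqrt_pos.2 hp)
  apply Real.sqrt_le_sqrt
  nlinarith

theorem aux_coef (c g h : ℝ) (hg : 0 ≤ g) (hgh : g ≤ h) :
    g * (1 + g / c ^ 2) ≤ h * (1 + h / c ^ 2) := by
  have : 0 ≤ g / c ^ 2 := by positivity
  have h2 : 0 ≤ h := hg.trans hgh
  gcongr

theorem aux_main (k a b r s p : ℝ) (hk : 0 < k) (ha : k ≤ a) (hb : k ≤ b) (hr : 0 ≤ r)
    (hs : 0 ≤ s) (hp : p ≤ r * s) (h1 : r ≤ s → a ≤ b) (h2 : s ≤ r → b ≤ a) :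
    k * (r ^ 2 - 2 * p + s ^ 2) ≤ a * r ^ 2 - (a + b) * p + b * s ^ 2 ∧
    k * (a * r ^ 2 - (a + b) * p + b * s ^ 2) ≤ a ^ 2 * r ^ 2 - 2 * (a * b) * p + b ^ 2 * s ^ 2 := by
  have A : 0 ≤ a - k := by linarith
  have B : 0 ≤ b - k := by linarith
  have e1 : 0 ≤ (a - k + (b - k)) * (r * s - p) :=
    mul_nonneg (by linarith) (by linarith)
  have e2 : 0 ≤ (a * (b - k) + b * (a - k)) * (r * s - p) :=
    mul_nonneg (add_nonneg (mul_nonneg (by linarith) B) (mul_nonneg (by linarith) A)) (by linarith)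
  have key : 0 ≤ (r - s) * ((a - k) * r - (b - k) * s) ∧
      0 ≤ (a * r - b * s) * ((a - k) * r - (b - k) * s) := by
    rcases le_total r s with h | h
    · have hab := h1 h
      have m1 : (a - k) * r ≤ (b - k) * s := mul_le_mul (by linarith) h hr B
      have m2 : a * r ≤ b * s := mul_le_mul hab h hr (by linarith)
      exact ⟨mul_nonneg_of_nonpos_of_nonpos (by linarith) (by linarith),
        mul_nonneg_of_nonpos_of_nonpos (by linarith) (by linarith)⟩
    · have hab := h2 h
      have m1 : (b - k) * s ≤ (a - k) * r := mul_le_mul (by linarith) h hs A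
      have m2 : b * s ≤ a * r := mul_le_mul hab h hs (by linarith)
      exact ⟨mul_nonneg (by linarith) (by linarith), mul_nonneg (by linarith) (by linarith)⟩
  constructor
  · linarith [key.1]
  · linarith [key.2]

theorem stmt8 (d : ℕ) (hd : 1 ≤ d) (c : ℝ) (hc : 0 < c)
    (v₁ v₂ : EuclideanSpace ℝ (Fin d)) (h₁ : ‖v₁‖ < c) (h₂ : ‖v₂‖ < c) :
    (c ^ 2 + 1) / c ^ 2 * ‖v₁ - v₂‖ ^ 2 ≤ ⟪v₁ - v₂, what c v₁ - what c v₂⟫ ∧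
    ⟪v₁ - v₂, what c v₁ - what c v₂⟫ ≤
      c ^ 2 / (c ^ 2 + 1) * ‖what c v₁ - what c v₂‖ ^ 2 := by
  have g1 := aux_gam_one c hc v₁ h₁
  have g2 := aux_gam_one c hc v₂ h₂
  have hk : (c ^ 2 + 1) / c ^ 2 = 1 * (1 + 1 / c ^ 2) := by field_simp
  have hk0 : 0 < (c ^ 2 + 1) / c ^ 2 := by positivity
  have hkinv : c ^ 2 / (c ^ 2 + 1) = ((c ^ 2 + 1) / c ^ 2)⁻¹ := by rw [inv_div]
  have ha := aux_coef c 1 _ zero_le_one g1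
  have hb := aux_coef c 1 _ zero_le_one g2
  rw [← hk] at ha hb
  have m1 := fun h : ‖v₁‖ ≤ ‖v₂‖ => aux_coef c _ _ (by linarith) (aux_gam_mono c hc v₁ v₂ h₂ h)
  have m2 := fun h : ‖v₂‖ ≤ ‖v₁‖ => aux_coef c _ _ (by linarith) (aux_gam_mono c hc v₂ v₁ h₁ h)
  rw [hkinv]
  unfold what
  generalize Gam c v₁ * (1 + Gam c v₁ / c ^ 2) = a at *
  generalize Gam c v₂ * (1 + Gam c v₂ / c ^ 2) = b at *
  generalize (c ^ 2 + 1) / c ^ 2 = k at *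
  have M := aux_main k a b ‖v₁‖ ‖v₂‖ ⟪v₁, v₂⟫ hk0 ha hb (norm_nonneg _) (norm_nonneg _)
    (real_inner_le_norm _ _) m1 m2
  have E1 : ‖v₁ - v₂‖ ^ 2 = ‖v₁‖ ^ 2 - 2 * ⟪v₁, v₂⟫ + ‖v₂‖ ^ 2 := norm_sub_sq_real _ _
  have E2 : ⟪v₁ - v₂, a • v₁ - b • v₂⟫ =
      a * ‖v₁‖ ^ 2 - (a + b) * ⟪v₁, v₂⟫ + b * ‖v₂‖ ^ 2 := by
    simp only [inner_sub_left, inner_sub_right, real_inner_smul_right,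
      real_inner_self_eq_norm_sq, real_inner_comm v₁ v₂]
    ring
  have E3 : ‖a • v₁ - b • v₂‖ ^ 2 =
      a ^ 2 * ‖v₁‖ ^ 2 - 2 * (a * b) * ⟪v₁, v₂⟫ + b ^ 2 * ‖v₂‖ ^ 2 := by
    rw [norm_sub_sq_real, real_inner_smul_left, real_inner_smul_right, norm_smul, norm_smul,
      mul_pow, mul_pow, Real.norm_eq_abs, Real.norm_eq_abs, sq_abs, sq_abs]
    ring
  rw [E1, E2, E3]
  exact ⟨M.1, (le_inv_mul_iff₀ hk0).2 M.2⟩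
end

section
/- The inverse map v̂ := ŵ⁻¹ : ℝ^d → B_c(0) is Lipschitz continuous with Lipschitz constant c²/(c² + 1): for all w₁, w₂ ∈ ℝ^d, ‖v̂(w₁) − v̂(w₂)‖ ≤ (c²/(c² + 1))·‖w₁ − w₂‖. -/
open Real

lemma Gam_mono (c : ℝ) (hc : 0 < c) {d : ℕ} (v w : EuclideanSpace ℝ (Fin d))
    (h : ‖v‖ ≤ ‖w‖) (hw : ‖w‖ < c) : Gam c v ≤ Gam c w := by
  unfold Gam
  have h0 := norm_nonneg v
  have h1 : 0 < c ^ 2 - ‖w‖ ^ 2 := by nlinarith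
  have h2 : c ^ 2 - ‖w‖ ^ 2 ≤ c ^ 2 - ‖v‖ ^ 2 := by nlinarith
  have h3 := Real.sqrt_pos.2 h1
  have h4 := Real.sqrt_le_sqrt h2
  exact div_le_div_of_nonneg_left hc.le h3 h4

lemma one_le_Gam (c : ℝ) (hc : 0 < c) {d : ℕ} (v : EuclideanSpace ℝ (Fin d))
    (hv : ‖v‖ < c) : 1 ≤ Gam c v := by
  have h := Gam_mono c hc 0 v (by simp) hv
  have h0 : Gam c (0 : EuclideanSpace ℝ (Fin d)) = 1 := by
    simp [Gam, Real.sqrt_sq hc.le, hc.ne']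
  linarith

lemma what_expand (c : ℝ) (hc : 0 < c) {d : ℕ} (v w : EuclideanSpace ℝ (Fin d))
    (h : ‖v‖ ≤ ‖w‖) (hw : ‖w‖ < c) :
    (1 + 1 / c ^ 2) * ‖v - w‖ ≤ ‖what c v - what c w‖ := by
  have hG := Gam_mono c hc v w h hw
  have hG1 := one_le_Gam c hc v (h.trans_lt hw)
  have key : ∀ a b : ℝ, 1 ≤ a → a ≤ b →
      a * (1 + a / c ^ 2) ≤ b * (1 + b / c ^ 2) := by
    intro a b ha hab
    have : a / c ^ 2 ≤ b / c ^ 2 := by gcongr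
    have : 0 ≤ a / c ^ 2 := by positivity
    gcongr
    linarith
  have k1 := key _ _ le_rfl hG1
  have k2 := key _ _ hG1 hG
  unfold what
  generalize Gam c v * (1 + Gam c v / c ^ 2) = f at *
  generalize Gam c w * (1 + Gam c w / c ^ 2) = g at *
  rw [one_mul] at k1
  generalize 1 + 1 / c ^ 2 = k at *
  have hin : inner ℝ (f • v - g • w) (v - w) =
      f * ‖v‖ ^ 2 + g * ‖w‖ ^ 2 - (f + g) * inner ℝ v w := by
    simp only [inner_sub_left, inner_sub_right, real_inner_smul_left,
      real_inner_self_eq_norm_sq, real_inner_comm v w]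
    ring
  have hns := norm_sub_sq_real v w
  have hcs := real_inner_le_norm v w
  have hcs2 := real_inner_le_norm (f • v - g • w) (v - w)
  have hv0 := norm_nonneg v
  have hmain : k * ‖v - w‖ ^ 2 ≤ inner ℝ (f • v - g • w) (v - w) := by
    rw [hin, hns]
    have a1 := mul_nonneg (by linarith : 0 ≤ (f - k) + (g - k)) (sub_nonneg.2 hcs)
    have a2 : 0 ≤ ((g - k) * ‖w‖ - (f - k) * ‖v‖) * (‖w‖ - ‖v‖) := by
      apply mul_nonneg _ (sub_nonneg.2 h)
      have : (f - k) * ‖v‖ ≤ (g - k) * ‖w‖ := by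
        apply mul_le_mul _ h hv0 <;> linarith
      linarith
    nlinarith
  rcases (norm_nonneg (v - w)).eq_or_lt with h0 | h0
  · rw [← h0]; simp
  · apply le_of_mul_le_mul_right _ h0
    nlinarith

theorem stmt9 (d : ℕ) (hd : 1 ≤ d) (c : ℝ) (hc : 0 < c)
    (vhat : EuclideanSpace ℝ (Fin d) → EuclideanSpace ℝ (Fin d))
    (hvhat_ball : ∀ w, ‖vhat w‖ < c)
    (hvhat_left : ∀ v : EuclideanSpace ℝ (Fin d), ‖v‖ < c → vhat (what c v) = v)
    (hvhat_right : ∀ w, what c (vhat w) = w) :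
    ∀ w₁ w₂ : EuclideanSpace ℝ (Fin d),
      ‖vhat w₁ - vhat w₂‖ ≤ c ^ 2 / (c ^ 2 + 1) * ‖w₁ - w₂‖ := by
  intro w₁ w₂
  have main : (1 + 1 / c ^ 2) * ‖vhat w₁ - vhat w₂‖ ≤ ‖w₁ - w₂‖ := by
    rcases le_total ‖vhat w₁‖ ‖vhat w₂‖ with h | h
    · have := what_expand c hc _ _ h (hvhat_ball w₂)
      rwa [hvhat_right, hvhat_right] at this
    · have := what_expand c hc _ _ h (hvhat_ball w₁)
      rwa [hvhat_right, hvhat_right, norm_sub_rev, norm_sub_rev w₂] at this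
  calc ‖vhat w₁ - vhat w₂‖
      = c ^ 2 / (c ^ 2 + 1) * ((1 + 1 / c ^ 2) * ‖vhat w₁ - vhat w₂‖) := by
        field_simp
    _ ≤ _ := by gcongr
end

section
/- The Lorentz factor, viewed as a function of the relativistic velocity, is (1/c)-Lipschitz: for all w₁, w₂ ∈ ℝ^d, |Γ(v̂(w₁)) − Γ(v̂(w₂))| ≤ (1/c)·‖w₁ − w₂‖, where v̂ := ŵ⁻¹. -/
open Real

theorem Gam_aux (c : ℝ) (hc : 0 < c) {d : ℕ} (v : EuclideanSpace ℝ (Fin d)) (hv : ‖v‖ < c) :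
    0 < Gam c v ∧ (Gam c v * ‖v‖) ^ 2 = c ^ 2 * (Gam c v ^ 2 - 1) ∧
    ‖what c v‖ = (Gam c v * ‖v‖) * (1 + Gam c v / c ^ 2) := by
  have h0 : 0 < c ^ 2 - ‖v‖ ^ 2 := by nlinarith [norm_nonneg v]
  have hg : 0 < Gam c v := div_pos hc (Real.sqrt_pos.2 h0)
  have hq : Gam c v ^ 2 * (c ^ 2 - ‖v‖ ^ 2) = c ^ 2 := by
    unfold Gam
    rw [div_pow, Real.sq_sqrt h0.le]
    field_simp
  refine ⟨hg, by linarith [hq, mul_pow (Gam c v) ‖v‖ 2], ?_⟩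
  unfold what
  rw [norm_smul, Real.norm_of_nonneg (by positivity)]
  ring

theorem Gam_le (c : ℝ) (hc : 0 < c) {d : ℕ} (v u : EuclideanSpace ℝ (Fin d)) (hv : ‖v‖ < c)
    (hu : ‖u‖ < c) : Gam c v - Gam c u ≤ (1 / c) * ‖what c v - what c u‖ := by
  obtain ⟨hg, hp, hw⟩ := Gam_aux c hc v hv
  obtain ⟨hk, hq, hz⟩ := Gam_aux c hc u hu
  rw [one_div, inv_mul_eq_div, le_div_iff₀ hc]
  by_cases hle : Gam c v ≤ Gam c u
  · nlinarith [norm_nonneg (what c v - what c u)]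
  push Not at hle
  refine le_trans ?_ (norm_sub_norm_le _ _)
  rw [hw, hz]
  have hp0 : 0 ≤ Gam c v * ‖v‖ := by positivity
  have hq0 : 0 ≤ Gam c u * ‖u‖ := by positivity
  generalize Gam c v * ‖v‖ = p at *
  generalize Gam c u * ‖u‖ = q at *
  generalize Gam c v = g at *
  generalize Gam c u = k at *
  have h1 : p ≤ c * g := abs_le_of_sq_le_sq' (by nlinarith [sq_nonneg c]) (by positivity) |>.2
  have h2 : q ≤ c * k := abs_le_of_sq_le_sq' (by nlinarith [sq_nonneg c]) (by positivity) |>.2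
  have hlt : q < p := by
    apply lt_of_pow_lt_pow_left₀ 2 hp0
    rw [hp, hq]
    have : k ^ 2 < g ^ 2 := by gcongr
    have : 0 < c ^ 2 := by positivity
    nlinarith
  have h3 : (g - k) * c ≤ p - q := by
    have hs : 0 < p + q := by linarith
    refine le_of_mul_le_mul_right ?_ hs
    have e : (p - q) * (p + q) = (g - k) * c * (c * g + c * k) := by linear_combination hp - hq
    rw [e]
    have : 0 ≤ (g - k) * c := mul_nonneg (by linarith) hc.le
    exact mul_le_mul_of_nonneg_left (by linarith) this
  have h4 : q * (k / c ^ 2) ≤ p * (g / c ^ 2) := by gcongr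
  linarith

theorem stmt11 (d : ℕ) (hd : 1 ≤ d) (c : ℝ) (hc : 0 < c)
    (vhat : EuclideanSpace ℝ (Fin d) → EuclideanSpace ℝ (Fin d))
    (hvhat_ball : ∀ w, ‖vhat w‖ < c)
    (hvhat_left : ∀ v : EuclideanSpace ℝ (Fin d), ‖v‖ < c → vhat (what c v) = v)
    (hvhat_right : ∀ w, what c (vhat w) = w) :
    ∀ w₁ w₂ : EuclideanSpace ℝ (Fin d),
      |Gam c (vhat w₁) - Gam c (vhat w₂)| ≤ (1 / c) * ‖w₁ - w₂‖ := by
  intro w₁ w₂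
  have h1 := Gam_le c hc _ _ (hvhat_ball w₁) (hvhat_ball w₂)
  have h2 := Gam_le c hc _ _ (hvhat_ball w₂) (hvhat_ball w₁)
  rw [hvhat_right, hvhat_right] at h1 h2
  rw [norm_sub_rev] at h2
  exact abs_le.2 ⟨by linarith, h1⟩
end

section
/- Let g : ℝ³ → ℝ be a nonnegative measurable function that is essentially bounded, and for α ≥ 0 set m_α g := ∫_{ℝ³} |w|^α g(w) dw (with values in [0, ∞]). Let 0 ≤ α < β and assume m_β g < ∞. Then m_α g ≤ ((4/3)·π·‖g‖_{L^∞(ℝ³)} + 1)·(m_β g)^{(α+3)/(β+3)}. -/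
open Real MeasureTheory ENNReal

/-- The `α`-th velocity moment `m_α g = ∫_{ℝ³} |w|^α g(w) dw`, valued in `[0, ∞]`. -/
noncomputable def velMoment (α : ℝ) (g : EuclideanSpace ℝ (Fin 3) → ℝ) : ℝ≥0∞ :=
  ∫⁻ w : EuclideanSpace ℝ (Fin 3), ENNReal.ofReal (‖w‖ ^ α * g w)

theorem velMoment_aux (g : EuclideanSpace ℝ (Fin 3) → ℝ)
    (hmeas : Measurable g) (hnonneg : ∀ w, 0 ≤ g w)
    (α β : ℝ) (hα : 0 ≤ α) (hαβ : α < β) (R : ℝ) (hR : 0 < R) :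
    velMoment α g ≤ ENNReal.ofReal (R ^ α) *
      eLpNorm g ⊤ (volume : Measure (EuclideanSpace ℝ (Fin 3))) *
        volume (Metric.ball (0 : EuclideanSpace ℝ (Fin 3)) R)
      + ENNReal.ofReal (R ^ (α - β)) * velMoment β g := by
  unfold velMoment
  rw [← lintegral_const_mul _ (by fun_prop), ← setLIntegral_const,
    ← lintegral_indicator Metric.isOpen_ball.measurableSet,
    ← lintegral_add_left (measurable_const.indicator Metric.isOpen_ball.measurableSet)]
  apply lintegral_mono_ae
  have h := ae_le_eLpNormEssSup (f := g) (μ := (volume : Measure (EuclideanSpace ℝ (Fin 3))))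
  filter_upwards [h] with w hw
  rw [← eLpNorm_exponent_top, Real.enorm_of_nonneg (hnonneg w)] at hw
  by_cases hb : w ∈ Metric.ball (0 : EuclideanSpace ℝ (Fin 3)) R
  · rw [Set.indicator_of_mem hb]
    refine le_trans ?_ le_self_add
    rw [ENNReal.ofReal_mul (by positivity)]
    have : ‖w‖ < R := by simpa using hb
    gcongr
  · rw [Set.indicator_of_notMem hb, zero_add, ← ENNReal.ofReal_mul (by positivity), ← mul_assoc]
    have hw' : R ≤ ‖w‖ := by simpa using hb
    have hp : 0 < ‖w‖ := hR.trans_le hw'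
    apply ENNReal.ofReal_le_ofReal
    apply mul_le_mul_of_nonneg_right _ (hnonneg w)
    have h1 : ‖w‖ ^ (α - β) ≤ R ^ (α - β) :=
      Real.rpow_le_rpow_of_nonpos hR hw' (by linarith)
    calc ‖w‖ ^ α = ‖w‖ ^ (α - β) * ‖w‖ ^ β := by
          rw [← Real.rpow_add hp]; ring_nf
      _ ≤ _ := by gcongr

theorem stmt14 (g : EuclideanSpace ℝ (Fin 3) → ℝ)
    (hmeas : Measurable g) (hnonneg : ∀ w, 0 ≤ g w)
    (hbdd : eLpNorm g ⊤ (volume : Measure (EuclideanSpace ℝ (Fin 3))) < ⊤)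
    (α β : ℝ) (hα : 0 ≤ α) (hαβ : α < β)
    (hβfin : velMoment β g < ⊤) :
    velMoment α g ≤
      ((4 / 3) * ENNReal.ofReal Real.pi *
          eLpNorm g ⊤ (volume : Measure (EuclideanSpace ℝ (Fin 3))) + 1) *
        velMoment β g ^ ((α + 3) / (β + 3)) := by
  by_cases h0 : velMoment β g = 0
  · have hz : velMoment α g = 0 := by
      unfold velMoment at h0 ⊢
      rw [lintegral_eq_zero_iff (by fun_prop)] at h0 ⊢
      filter_upwards [h0, Measure.ae_ne volume (0 : EuclideanSpace ℝ (Fin 3))] with w hw hne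
      have hp : 0 < ‖w‖ := norm_pos_iff.mpr hne
      simp only [Pi.zero_apply, ENNReal.ofReal_eq_zero] at hw ⊢
      have := Real.rpow_pos_of_pos hp β
      have hg : g w = 0 := by
        have := hnonneg w
        by_contra hgne
        have : 0 < g w := lt_of_le_of_ne this (Ne.symm hgne)
        have : 0 < ‖w‖ ^ β * g w := by positivity
        linarith
      simp [hg]
    rw [hz]; exact zero_le
  set M := (velMoment β g).toReal with hM
  have hMe : velMoment β g = ENNReal.ofReal M := (ENNReal.ofReal_toReal hβfin.ne).symm
  have hMp : 0 < M := ENNReal.toReal_pos h0 hβfin.ne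
  have hb3 : 0 < β + 3 := by linarith
  set R := M ^ (1 / (β + 3)) with hRd
  have hR : 0 < R := Real.rpow_pos_of_pos hMp _
  have hRM : M = R ^ (β + 3) := by
    rw [hRd, ← Real.rpow_mul hMp.le, one_div_mul_cancel hb3.ne', Real.rpow_one]
  have hMR : velMoment β g ^ ((α + 3) / (β + 3)) = ENNReal.ofReal (R ^ (α + 3)) := by
    rw [hMe, ENNReal.ofReal_rpow_of_pos hMp, hRd, ← Real.rpow_mul hMp.le]
    congr 2; ring
  refine (velMoment_aux g hmeas hnonneg α β hα hαβ R hR).trans ?_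
  rw [hMR, add_mul, one_mul, EuclideanSpace.volume_ball_fin_three]
  apply le_of_eq
  congr 1
  · have h3 : ENNReal.ofReal (R ^ (α + 3)) = ENNReal.ofReal (R ^ α) * ENNReal.ofReal R ^ 3 := by
      rw [← ENNReal.ofReal_pow hR.le, ← ENNReal.ofReal_mul (by positivity), Real.rpow_add hR]
      norm_cast
    have h4 : ENNReal.ofReal (π * 4 / 3) = (4 / 3) * ENNReal.ofReal π := by
      rw [show π * 4 / 3 = (4 / 3) * π by ring, ENNReal.ofReal_mul (by positivity),
        ENNReal.ofReal_div_of_pos (by norm_num)]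
      simp
    rw [h3, ← h4]
    ring
  · rw [hMe, ← ENNReal.ofReal_mul (by positivity)]
    conv_lhs => rw [hRM]
    rw [← Real.rpow_add hR]
    ring_nf
end

section
/- Let X be a measurable space equipped with a probability measure μ, and let ν be a probability measure on X × ℝ³ whose velocity second moment ∫ ‖w‖² dν(x, w) is finite. Let u : X → ℝ³ be measurable with u square-integrable with respect to μ and with (x, w) ↦ u(x) square-integrable with respect to ν. Set u_c := ∫_X u dμ and w_c := ∫_{X×ℝ³} w dν(x, w). Then (1/2)·‖u_c − w_c‖² + (1/2)·∫_{X×ℝ³} ‖w − w_c‖² dν(x, w) ≤ ∫_{X×ℝ³} ‖u(x) − u_c‖² dν(x, w) + ∫_{X×ℝ³} ‖u(x) − w‖² dν(x, w). -/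
open MeasureTheory

theorem stmt17 (X : Type*) [MeasurableSpace X]
    (μ : Measure X) [IsProbabilityMeasure μ]
    (ν : Measure (X × EuclideanSpace ℝ (Fin 3))) [IsProbabilityMeasure ν]
    (hmom : Integrable (fun p : X × EuclideanSpace ℝ (Fin 3) => ‖p.2‖ ^ 2) ν)
    (u : X → EuclideanSpace ℝ (Fin 3)) (humeas : Measurable u)
    (hu2 : MemLp u 2 μ)
    (hu2ν : MemLp (fun p : X × EuclideanSpace ℝ (Fin 3) => u p.1) 2 ν)
    (uc wc : EuclideanSpace ℝ (Fin 3))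
    (huc : uc = ∫ x, u x ∂μ)
    (hwc : wc = ∫ p : X × EuclideanSpace ℝ (Fin 3), p.2 ∂ν) :
    (1 / 2) * ‖uc - wc‖ ^ 2 +
        (1 / 2) * ∫ p : X × EuclideanSpace ℝ (Fin 3), ‖p.2 - wc‖ ^ 2 ∂ν ≤
      (∫ p : X × EuclideanSpace ℝ (Fin 3), ‖u p.1 - uc‖ ^ 2 ∂ν) +
        ∫ p : X × EuclideanSpace ℝ (Fin 3), ‖u p.1 - p.2‖ ^ 2 ∂ν := by
  have hw : MemLp (fun p : X × EuclideanSpace ℝ (Fin 3) => p.2) 2 ν :=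
    (memLp_two_iff_integrable_sq_norm measurable_snd.aestronglyMeasurable).2 hmom
  have hwi : Integrable (fun p : X × EuclideanSpace ℝ (Fin 3) => p.2) ν :=
    hw.integrable (by norm_num)
  have i1 : Integrable (fun p : X × EuclideanSpace ℝ (Fin 3) => ‖p.2 - wc‖ ^ 2) ν :=
    (hw.sub (memLp_const wc)).integrable_norm_pow (by norm_num)
  have i2 : Integrable (fun p : X × EuclideanSpace ℝ (Fin 3) => ‖u p.1 - uc‖ ^ 2) ν :=
    (hu2ν.sub (memLp_const uc)).integrable_norm_pow (by norm_num)
  have i3 : Integrable (fun p : X × EuclideanSpace ℝ (Fin 3) => ‖u p.1 - p.2‖ ^ 2) ν :=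
    (hu2ν.sub hw).integrable_norm_pow (by norm_num)
  have hci : Integrable (fun p : X × EuclideanSpace ℝ (Fin 3) => p.2 - wc) ν :=
    hwi.sub (integrable_const wc)
  have i4 : Integrable
      (fun p : X × EuclideanSpace ℝ (Fin 3) => inner ℝ (uc - wc) (p.2 - wc)) ν :=
    hci.const_inner (uc - wc)
  have h0 : ∫ p : X × EuclideanSpace ℝ (Fin 3), inner ℝ (uc - wc) (p.2 - wc) ∂ν = 0 := by
    rw [integral_inner hci, integral_sub hwi (integrable_const wc), ← hwc]
    simp
  have i5 : Integrable (fun p : X × EuclideanSpace ℝ (Fin 3) =>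
      (1 / 2) * ‖uc - wc‖ ^ 2 + (1 / 2) * ‖p.2 - wc‖ ^ 2) ν :=
    (integrable_const _).add (i1.const_mul _)
  have key : ∫ p : X × EuclideanSpace ℝ (Fin 3),
      ((1 / 2) * ‖uc - wc‖ ^ 2 + (1 / 2) * ‖p.2 - wc‖ ^ 2 - inner ℝ (uc - wc) (p.2 - wc)) ∂ν ≤
      ∫ p : X × EuclideanSpace ℝ (Fin 3), (‖u p.1 - uc‖ ^ 2 + ‖u p.1 - p.2‖ ^ 2) ∂ν := by
    refine integral_mono (i5.sub i4) (i2.add i3) fun p => ?_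
    have e1 := norm_sub_sq_real (uc - wc) (p.2 - wc)
    have e2 := parallelogram_law_with_norm ℝ (u p.1 - uc) (u p.1 - p.2)
    have e3 : (u p.1 - uc) - (u p.1 - p.2) = -((uc - wc) - (p.2 - wc)) := by abel
    rw [e3, norm_neg] at e2
    have := mul_self_nonneg ‖u p.1 - uc + (u p.1 - p.2)‖
    dsimp only
    nlinarith
  rw [integral_sub i5 i4, h0, integral_add (integrable_const _) (i1.const_mul _),
    integral_add i2 i3] at key
  simpa [integral_const_mul] using key
end
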